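/- arXiv:math/0306396 — 2 statements merged into one kernel-verified Lean document; each statement's English description precedes it below -/
import Mathlib

section
/- Cramer's rule via Berezin integrals: if A is an invertible m×m matrix over a field of characteristic zero, then (A⁻¹)ᵢⱼ = [∫ (dψ̄ dψ)_ent ψᵢ ψ̄ⱼ exp(−ψ̄Aψ)] / [∫ (dψ̄ dψ)_ent exp(−ψ̄Aψ)]. -/
set_option synthInstance.maxHeartbeats 1000000
set_option maxHeartbeats 1000000

noncomputable section

variable {R : Type*} [CommRing R] [Algebra ℚ R]

/-- The Grassmann algebra on anticommuting generators indexed by `ι`,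
realized as the exterior algebra of the free module `ι → R`. -/
abbrev GA (R : Type*) [CommRing R] (ι : Type*) : Type _ :=
  ExteriorAlgebra R (ι → R)

/-- The generator `χ i` of the Grassmann algebra. -/
def gaGen {R : Type*} [CommRing R] {ι : Type*} [DecidableEq ι] (i : ι) : GA R ι :=
  ExteriorAlgebra.ι R (Pi.single i 1)

/-- The odd derivation `∂/∂χ i` (left contraction with the `i`-th coordinate functional). -/
def gaDeriv {R : Type*} [CommRing R] {ι : Type*} [DecidableEq ι] (i : ι) :
    GA R ι →ₗ[R] GA R ι :=
  CliffordAlgebra.contractLeft (Q := (0 : QuadraticForm R (ι → R))) (LinearMap.proj i)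

/-- Iterated Berezin integration: `bint [τ 1, …, τ p] f = ∂/∂χ_{τ 1} ∘ ⋯ ∘ ∂/∂χ_{τ p} f`. -/
def bint {R : Type*} [CommRing R] {ι : Type*} [DecidableEq ι] :
    List ι → GA R ι → GA R ι
  | [], f => f
  | i :: t, f => gaDeriv i (bint t f)

/-- The scalar (degree-0) part of an element of the Grassmann algebra. -/
def gaCoef {R : Type*} [CommRing R] {ι : Type*} : GA R ι →ₐ[R] R :=
  ExteriorAlgebra.algebraMapInv

/-- The (terminating) exponential of an element of the augmentation ideal of the
Grassmann algebra on finitely many generators. -/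
def gexp {R : Type*} [CommRing R] [Algebra ℚ R] {ι : Type*} [Fintype ι] (f : GA R ι) :
    GA R ι :=
  ∑ p ∈ Finset.range (Fintype.card ι + 1), algebraMap ℚ R (p.factorial : ℚ)⁻¹ • f ^ p


/-- The generator `ψ i` in the Grassmann algebra on `2m` generators. -/
def psi {R : Type*} [CommRing R] {m : ℕ} (i : Fin m) : GA R (Fin m ⊕ Fin m) :=
  gaGen (Sum.inl i)

/-- The generator `ψ̄ i` in the Grassmann algebra on `2m` generators. -/
def psibar {R : Type*} [CommRing R] {m : ℕ} (i : Fin m) : GA R (Fin m ⊕ Fin m) :=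
  gaGen (Sum.inr i)

/-- The entangled order of Berezin integration `dψ̄₁ dψ₁ dψ̄₂ dψ₂ ⋯ dψ̄_m dψ_m`. -/
def entList (m : ℕ) : List (Fin m ⊕ Fin m) :=
  (List.ofFn (fun i : Fin m => [Sum.inr i, Sum.inl i])).flatten

/-- The quadratic element `ψ̄ A ψ = Σ_{i,j} ψ̄ᵢ Aᵢⱼ ψⱼ`. -/
def quadPsi {R : Type*} [CommRing R] {m : ℕ} (A : Matrix (Fin m) (Fin m) R) :
    GA R (Fin m ⊕ Fin m) :=
  ∑ i : Fin m, ∑ j : Fin m, A i j • (psibar i * psi j)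

section helpers

variable {K : Type*} [Field K] {ι : Type*} [DecidableEq ι]

theorem gaDeriv_ι_mul (k : ι) (a : ι → K) (g : GA K ι) :
    gaDeriv k (ExteriorAlgebra.ι K a * g) = a k • g - ExteriorAlgebra.ι K a * gaDeriv k g :=
  CliffordAlgebra.contractLeft_ι_mul (Q := (0 : QuadraticForm K (ι → K))) (LinearMap.proj k) a g

theorem gaDeriv_algebraMap (k : ι) (r : K) :
    gaDeriv k (algebraMap K (GA K ι) r) = 0 :=
  CliffordAlgebra.contractLeft_algebraMap (Q := (0 : QuadraticForm K (ι → K))) (LinearMap.proj k) r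

theorem gaDeriv_one (k : ι) : gaDeriv k (1 : GA K ι) = 0 :=
  CliffordAlgebra.contractLeft_one (Q := (0 : QuadraticForm K (ι → K))) (LinearMap.proj k)

theorem gaDeriv_gaDeriv (k : ι) (g : GA K ι) : gaDeriv k (gaDeriv k g) = 0 :=
  CliffordAlgebra.contractLeft_contractLeft (Q := (0 : QuadraticForm K (ι → K))) (LinearMap.proj k) g

theorem gaDeriv_comm (k l : ι) (g : GA K ι) : gaDeriv k (gaDeriv l g) = - gaDeriv l (gaDeriv k g) :=
  CliffordAlgebra.contractLeft_comm (Q := (0 : QuadraticForm K (ι → K)))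
    (LinearMap.proj k) (LinearMap.proj l) g

theorem ι_swap (a b : ι → K) : ExteriorAlgebra.ι K a * ExteriorAlgebra.ι K b =
    - (ExteriorAlgebra.ι K b * ExteriorAlgebra.ι K a) :=
  eq_neg_of_add_eq_zero_left (ExteriorAlgebra.ι_add_mul_swap a b)

/-- Berezin integral as a linear map. -/
def bintL : List ι → (GA K ι →ₗ[K] GA K ι)
  | [] => LinearMap.id
  | i :: t => gaDeriv i ∘ₗ bintL t

theorem bintL_apply (L : List ι) (g : GA K ι) : bintL L g = bint L g := by
  induction L with
  | nil => rfl
  | cons a t ih => simp [bintL, bint, ih]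

theorem bint_gaDeriv (L : List ι) (k : ι) (g : GA K ι) :
    bint L (gaDeriv k g) = (-1 : K) ^ L.length • gaDeriv k (bint L g) := by
  induction L with
  | nil => simp [bint]
  | cons a t ih =>
    simp only [bint, ih, map_smul, List.length_cons, pow_succ]
    rw [gaDeriv_comm a k]
    simp

theorem bint_gaDeriv_zero (L : List ι) (k : ι) (hk : k ∈ L) (g : GA K ι) :
    bint L (gaDeriv k g) = 0 := by
  induction L with
  | nil => simp at hk
  | cons a t ih =>
    rcases List.mem_cons.1 hk with rfl | h
    · simp [bint, bint_gaDeriv, gaDeriv_gaDeriv]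
    · simp [bint, ih h]

theorem gaDeriv_prod (L : List ι) (k : ι) (hk : k ∉ L) :
    gaDeriv k (L.map (gaGen (R := K))).prod = 0 := by
  induction L with
  | nil => simp [gaDeriv_one]
  | cons a t ih =>
    simp only [List.mem_cons, not_or] at hk
    simp only [List.map_cons, List.prod_cons]
    rw [gaGen, gaDeriv_ι_mul, ih hk.2]
    simp [hk.1]

theorem bint_append (L L' : List ι) (g : GA K ι) : bint (L ++ L') g = bint L (bint L' g) := by
  induction L with
  | nil => rfl
  | cons a t ih => simp [bint, ih]

theorem bint_prod (L : List ι) (hL : L.Nodup) :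
    bint L.reverse (L.map (gaGen (R := K))).prod = 1 := by
  induction L with
  | nil => simp [bint]
  | cons a t ih =>
    rw [List.nodup_cons] at hL
    simp only [List.reverse_cons, bint_append, bint, List.map_cons, List.prod_cons]
    rw [gaGen, gaDeriv_ι_mul, gaDeriv_prod t a hL.1]
    simpa using ih hL.2

/-- the degree one part -/
abbrev gV (K : Type*) [Field K] (ι : Type*) : Submodule K (GA K ι) :=
  LinearMap.range (ExteriorAlgebra.ι K (M := ι → K))

theorem gaDeriv_pow (k : ι) (n : ℕ) (g : GA K ι) (hg : g ∈ gV K ι ^ (n+1)) :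
    gaDeriv k g ∈ gV K ι ^ n := by
  induction n generalizing g with
  | zero =>
    rw [zero_add, pow_one] at hg
    obtain ⟨a, rfl⟩ := hg
    have := gaDeriv_ι_mul k a 1
    rw [mul_one, gaDeriv_one, mul_zero, sub_zero] at this
    rw [this, pow_zero]
    exact Submodule.smul_mem _ _ (Submodule.mem_one.2 ⟨1, map_one _⟩)
  | succ n ih =>
    rw [pow_succ'] at hg
    induction hg using Submodule.mul_induction_on' with
    | mem_mul_mem x hx y hy =>
      obtain ⟨a, rfl⟩ := hx
      rw [gaDeriv_ι_mul]
      refine Submodule.sub_mem _ (Submodule.smul_mem _ _ hy) ?_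
      rw [pow_succ']
      exact Submodule.mul_mem_mul ⟨a, rfl⟩ (ih y hy)
    | add x _ y _ hx hy => rw [map_add]; exact Submodule.add_mem _ hx hy

theorem gV_pow_eq_zero [Fintype ι] (n : ℕ) (hn : Fintype.card ι < n) (g : GA K ι)
    (hg : g ∈ gV K ι ^ n) : g = 0 := by
  have h := exteriorPower.finrank_eq (R := K) (M := ι → K) (n := n)
  rw [Module.finrank_fintype_fun_eq_card, Nat.choose_eq_zero_of_lt hn] at h
  have : Module.Finite K (⋀[K]^n (ι → K)) := inferInstance
  have h2 := Submodule.finrank_eq_zero.1 h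
  have h3 : g ∈ ⋀[K]^n (ι → K) := hg
  rw [h2] at h3
  simpa using h3

theorem functional_zero (J : GA K ι →ₗ[K] K) (h0 : J 1 = 0)
    (hJ : ∀ a : ι → K, ∃ D : GA K ι →ₗ[K] GA K ι,
      (D 1 = 0 ∧ ∀ n, ∀ g ∈ gV K ι ^ (n+1), D g ∈ gV K ι ^ n) ∧
      ∀ g, J (ExteriorAlgebra.ι K a * g) = J (D g)) : J = 0 := by
  have key : ∀ n, ∀ g ∈ gV K ι ^ n, J g = 0 := by
    intro n
    induction n using Nat.strong_induction_on with
    | _ n ih =>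
    intro g hg
    rcases n with _ | n
    · rw [pow_zero] at hg
      obtain ⟨r, rfl⟩ := Submodule.mem_one.1 hg
      rw [Algebra.algebraMap_eq_smul_one, map_smul, h0, smul_zero]
    · rw [pow_succ'] at hg
      induction hg using Submodule.mul_induction_on' with
      | mem_mul_mem x hx y hy =>
        obtain ⟨a, rfl⟩ := hx
        obtain ⟨D, ⟨hD1, hD2⟩, h⟩ := hJ a
        rw [h]
        rcases n with _ | n
        · rw [pow_zero] at hy
          obtain ⟨r, rfl⟩ := Submodule.mem_one.1 hy
          rw [Algebra.algebraMap_eq_smul_one, map_smul, hD1, smul_zero, map_zero]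
        · exact ih n (by omega) _ (hD2 n y hy)
      | add x _ y _ hx hy => rw [map_add, hx, hy, add_zero]
  refine LinearMap.ext fun x => ?_
  induction x using DirectSum.Decomposition.inductionOn fun i => ⋀[K]^i (ι → K) with
  | zero => simp
  | add _ _ hm hm' => rw [map_add, hm, hm']; simp
  | homogeneous hm => exact key _ _ hm.2

variable [Fintype ι] [CharZero K]

theorem gaDeriv_gexp (k : ι) (f v : GA K ι) (hv : v ∈ gV K ι) (hf : f ∈ gV K ι ^ 2)
    (hc : v * f = f * v)
    (hd : ∀ g, gaDeriv k (f * g) = v * g + f * gaDeriv k g) (g : GA K ι) :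
    gaDeriv k (gexp f * g) = gexp f * (v * g + gaDeriv k g) := by
  have hcp : ∀ p : ℕ, v * f ^ p = f ^ p * v := fun p => ((show Commute v f from hc).pow_right p).eq
  have hpow : ∀ p : ℕ, ∀ g, gaDeriv k (f ^ (p+1) * g) =
      ((p + 1 : ℕ) : K) • (f ^ p * (v * g)) + f ^ (p+1) * gaDeriv k g := by
    intro p
    induction p with
    | zero => intro g; simp [hd]
    | succ p ih =>
      intro g
      rw [pow_succ' f (p+1), mul_assoc, hd, ih, mul_add, mul_smul_comm, ← mul_assoc f (f^p),
        ← pow_succ', ← mul_assoc v, hcp, mul_assoc, ← mul_assoc f (f^(p+1)) (gaDeriv k g),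
        ← add_assoc]
      congr 1
      push_cast
      module
  have hz : f ^ (Fintype.card ι) * v = 0 := by
    apply gV_pow_eq_zero (2 * Fintype.card ι + 1) (by omega)
    rw [pow_succ, pow_mul]
    exact Submodule.mul_mem_mul (Submodule.pow_mem_pow _ hf _) hv
  unfold gexp
  rw [Finset.sum_mul, map_sum, mul_add, Finset.sum_mul, Finset.sum_mul]
  rw [Finset.sum_range_succ', Finset.sum_range_succ (fun p => _ * (v * g)),
    Finset.sum_range_succ' (fun p => _ * gaDeriv k g)]
  have e1 : (algebraMap ℚ K ((Fintype.card ι).factorial : ℚ)⁻¹ • f ^ (Fintype.card ι)) * (v * g) = 0 := by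
    rw [smul_mul_assoc, ← mul_assoc, hz, zero_mul, smul_zero]
  rw [e1, add_zero, ← add_assoc, ← Finset.sum_add_distrib]
  congr 1
  · refine Finset.sum_congr rfl fun p _ => ?_
    rw [smul_mul_assoc, map_smul, hpow, smul_add, smul_smul, smul_mul_assoc, smul_mul_assoc]
    congr 2
    have : ((p:K)+1) ≠ 0 := by exact_mod_cast Nat.succ_ne_zero p
    have : (p.factorial : K) ≠ 0 := by exact_mod_cast p.factorial_ne_zero
    simp only [Nat.factorial_succ, map_inv₀, map_natCast]
    push_cast
    field_simp
  · simp

theorem isUnit_gexp (f : GA K ι) (hf : f ∈ gV K ι ^ 2) : IsUnit (gexp f) := by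
  have hn : IsNilpotent f := by
    refine ⟨Fintype.card ι + 1, gV_pow_eq_zero (2 * (Fintype.card ι + 1)) (by omega) _ ?_⟩
    rw [pow_mul]
    exact Submodule.pow_mem_pow _ hf _
  unfold gexp
  rw [Finset.sum_range_succ', add_comm]
  simp only [Nat.factorial_zero, Nat.cast_one, inv_one, map_one, pow_zero, one_smul]
  apply IsNilpotent.isUnit_one_add
  simp_rw [pow_succ', ← mul_smul_comm]
  rw [← Finset.mul_sum]
  refine Commute.isNilpotent_mul_right ?_ hn
  refine Commute.sum_right _ _ _ fun p _ => ?_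
  exact ((Commute.refl f).pow_right p).smul_right _

theorem commute_gexp (f x : GA K ι) (h : Commute x f) : Commute x (gexp f) :=
  Commute.sum_right _ _ _ fun p _ => (h.pow_right p).smul_right _

end helpers

section main

variable {K : Type*} [Field K] {m : ℕ}

theorem entList_mem (k : Fin m ⊕ Fin m) : k ∈ entList m := by
  rcases k with k | k <;> simp [entList, List.mem_flatten, List.mem_ofFn]

theorem entList_nodup : (entList m).Nodup := by
  unfold entList
  rw [List.nodup_flatten]
  constructor
  · intro l hl
    obtain ⟨i, rfl⟩ := (List.mem_ofFn' _ _).1 hl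
    simp
  · rw [List.pairwise_ofFn]
    intro i j hij
    have := hij.ne'
    simp [List.disjoint_left, this.symm]

/-- derivative of minus the quadratic form -/
def vv (A : Matrix (Fin m) (Fin m) K) : Fin m ⊕ Fin m → GA K (Fin m ⊕ Fin m)
  | Sum.inl j => ∑ i, A i j • psibar i
  | Sum.inr i => - ∑ j, A i j • psi j

theorem psi_mem (i : Fin m) : psi i ∈ gV K (Fin m ⊕ Fin m) := ⟨_, rfl⟩

theorem psibar_mem (i : Fin m) : psibar i ∈ gV K (Fin m ⊕ Fin m) := ⟨_, rfl⟩

theorem vv_mem (A : Matrix (Fin m) (Fin m) K) (k : Fin m ⊕ Fin m) :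
    vv A k ∈ gV K (Fin m ⊕ Fin m) := by
  rcases k with k | k
  · exact Submodule.sum_mem _ fun i _ => Submodule.smul_mem _ _ (psibar_mem i)
  · exact Submodule.neg_mem _ (Submodule.sum_mem _ fun i _ => Submodule.smul_mem _ _ (psi_mem i))

theorem quad_mem (A : Matrix (Fin m) (Fin m) K) :
    -quadPsi A ∈ gV K (Fin m ⊕ Fin m) ^ 2 := by
  refine Submodule.neg_mem _ (Submodule.sum_mem _ fun i _ => Submodule.sum_mem _ fun j _ =>
    Submodule.smul_mem _ _ ?_)
  rw [pow_two]
  exact Submodule.mul_mem_mul (psibar_mem i) (psi_mem j)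

theorem quad_comm (A : Matrix (Fin m) (Fin m) K) (v : GA K (Fin m ⊕ Fin m))
    (hv : v ∈ gV K (Fin m ⊕ Fin m)) : Commute v (-quadPsi A) := by
  obtain ⟨a, rfl⟩ := hv
  refine Commute.neg_right (Commute.sum_right _ _ _ fun i _ => Commute.sum_right _ _ _ fun j _ =>
    Commute.smul_right ?_ _)
  unfold psibar psi gaGen Commute SemiconjBy
  rw [← mul_assoc, ι_swap a, neg_mul, mul_assoc, ι_swap a, mul_neg, neg_neg, mul_assoc]

theorem quad_deriv (A : Matrix (Fin m) (Fin m) K) (k : Fin m ⊕ Fin m)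
    (g : GA K (Fin m ⊕ Fin m)) :
    gaDeriv k (-quadPsi A * g) = vv A k * g + -quadPsi A * gaDeriv k g := by
  have h1 : ∀ i j, gaDeriv k (psibar i * psi j * g) =
      ((Pi.single (Sum.inr i) 1 : Fin m ⊕ Fin m → K) k • (psi j * g)
        - (Pi.single (Sum.inl j) 1 : Fin m ⊕ Fin m → K) k • (psibar i * g))
        + psibar i * psi j * gaDeriv k g := by
    intro i j
    unfold psibar psi gaGen
    rw [mul_assoc, gaDeriv_ι_mul, gaDeriv_ι_mul, mul_sub, mul_smul_comm, mul_assoc]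
    abel
  unfold quadPsi
  simp only [neg_mul, map_neg, Finset.sum_mul, map_sum, smul_mul_assoc, map_smul, h1, smul_add,
    Finset.sum_add_distrib, neg_add]
  congr 1
  rcases k with k | k
  · simp [vv, Finset.sum_mul, Pi.single_apply, Finset.sum_ite_eq]
  · simp [vv, Finset.sum_mul, Pi.single_apply, Finset.sum_ite_eq, ← Finset.smul_sum]

variable [CharZero K]

/-- the functional `g ↦ ∫ e^{-ψ̄Aψ} g` -/
def JJ (A : Matrix (Fin m) (Fin m) K) : GA K (Fin m ⊕ Fin m) →ₗ[K] K :=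
  gaCoef.toLinearMap ∘ₗ bintL (entList m) ∘ₗ LinearMap.mulLeft K (gexp (-quadPsi A))

theorem JJ_apply (A : Matrix (Fin m) (Fin m) K) (g : GA K (Fin m ⊕ Fin m)) :
    JJ A g = gaCoef (bint (entList m) (gexp (-quadPsi A) * g)) := by
  simp [JJ, bintL_apply]

theorem JJ_SD (A : Matrix (Fin m) (Fin m) K) (k : Fin m ⊕ Fin m) (g : GA K (Fin m ⊕ Fin m)) :
    JJ A (vv A k * g) = - JJ A (gaDeriv k g) := by
  rw [eq_neg_iff_add_eq_zero, ← map_add, JJ_apply,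
    ← gaDeriv_gexp k _ _ (vv_mem A k) (quad_mem A) (quad_comm A _ (vv_mem A k)) (quad_deriv A k),
    bint_gaDeriv_zero _ _ (entList_mem k), map_zero]

theorem span_vv (A : Matrix (Fin m) (Fin m) K) (hA : IsUnit A.det) (a : Fin m ⊕ Fin m → K) :
    ∃ c : Fin m ⊕ Fin m → K, ExteriorAlgebra.ι K a = ∑ k, c k • vv A k := by
  have hgen : ∀ l, gaGen l ∈ Submodule.span K (Set.range (vv A)) := by
    intro l
    rcases l with l | l
    · have : gaGen (Sum.inl l) = - ∑ k, A⁻¹ l k • vv A (Sum.inr k) := by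
        simp only [vv, smul_neg, Finset.sum_neg_distrib, neg_neg, Finset.smul_sum, smul_smul]
        rw [Finset.sum_comm]
        simp only [← Finset.sum_smul, ← Matrix.mul_apply, Matrix.nonsing_inv_mul A hA,
          Matrix.one_apply]
        simp [psi]
      rw [this]
      exact Submodule.neg_mem _ (Submodule.sum_mem _ fun i _ => Submodule.smul_mem _ _
        (Submodule.subset_span ⟨_, rfl⟩))
    · have : gaGen (Sum.inr l) = ∑ k, A⁻¹ k l • vv A (Sum.inl k) := by
        simp only [vv, Finset.smul_sum, smul_smul]
        rw [Finset.sum_comm]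
        simp only [mul_comm (A⁻¹ _ _), ← Finset.sum_smul, ← Matrix.mul_apply,
          Matrix.mul_nonsing_inv A hA, Matrix.one_apply]
        simp [psibar]
      rw [this]
      exact (Submodule.sum_mem _ fun i _ => Submodule.smul_mem _ _
        (Submodule.subset_span ⟨_, rfl⟩))
  have : ExteriorAlgebra.ι K a ∈ Submodule.span K (Set.range (vv A)) := by
    rw [pi_eq_sum_univ' a, map_sum]
    refine Submodule.sum_mem _ fun i _ => ?_
    rw [map_smul]
    refine Submodule.smul_mem _ _ ?_
    exact hgen i
  obtain ⟨c, hc⟩ := (Submodule.mem_span_range_iff_exists_fun K).1 this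
  exact ⟨c, hc.symm⟩

theorem JJ_one_ne (A : Matrix (Fin m) (Fin m) K) (hA : IsUnit A.det) : JJ A 1 ≠ 0 := by
  intro h0
  have hz : JJ A = 0 := by
    refine functional_zero _ h0 fun a => ?_
    obtain ⟨c, hc⟩ := span_vv A hA a
    refine ⟨-∑ k, c k • gaDeriv (R := K) k, ⟨?_, ?_⟩, ?_⟩
    · simp [gaDeriv_one]
    · intro n g hg
      simp only [LinearMap.neg_apply, LinearMap.sum_apply, LinearMap.smul_apply]
      exact Submodule.neg_mem _ (Submodule.sum_mem _ fun k _ => Submodule.smul_mem _ _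
        (gaDeriv_pow k n g hg))
    · intro g
      simp only [hc, Finset.sum_mul, smul_mul_assoc, map_sum, map_smul, JJ_SD,
        LinearMap.neg_apply, LinearMap.sum_apply, LinearMap.smul_apply, map_neg,
        smul_neg, Finset.sum_neg_distrib]
  obtain ⟨u, hu⟩ := isUnit_gexp _ (quad_mem A)
  have h := JJ_apply A ((↑u⁻¹ : GA K (Fin m ⊕ Fin m)) *
    ((entList m).reverse.map (gaGen (R := K))).prod)
  rw [hz, ← hu, ← mul_assoc, Units.mul_inv, one_mul] at h
  have h2 := bint_prod (K := K) (entList m).reverse (List.nodup_reverse.2 entList_nodup)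
  rw [List.reverse_reverse] at h2
  rw [h2] at h
  simp at h

end main

/-- Cramer's rule via Berezin integrals: for an invertible matrix `A` over a field of
characteristic zero,
`(A⁻¹)ᵢⱼ = (∫ (dψ̄ dψ)_ent ψᵢ ψ̄ⱼ e^{-ψ̄Aψ}) / (∫ (dψ̄ dψ)_ent e^{-ψ̄Aψ})`. -/
theorem cramer_berezin {K : Type*} [Field K] [CharZero K] (m : ℕ)
    (A : Matrix (Fin m) (Fin m) K) (hA : IsUnit A.det) (i j : Fin m) :
    A⁻¹ i j =
      gaCoef (bint (entList m) (psi i * psibar j * gexp (-(quadPsi A)))) /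
        gaCoef (bint (entList m) (gexp (-(quadPsi A)))) := by
  have hZ := JJ_one_ne A hA
  have hN : ∀ i j, gaCoef (bint (entList m) (psi i * psibar j * gexp (-(quadPsi A)))) =
      JJ A (psi i * psibar j) := by
    intro i j
    rw [JJ_apply, ((commute_gexp _ _ (quad_comm A _ (psi_mem i))).mul_left
      (commute_gexp _ _ (quad_comm A _ (psibar_mem j)))).eq]
  have hZ' : gaCoef (bint (entList m) (gexp (-(quadPsi A)))) = JJ A 1 := by
    rw [JJ_apply, mul_one]
  rw [hN, hZ', eq_div_iff hZ]
  have hM : A * Matrix.of (fun i j => JJ A (psi i * psibar j)) = JJ A 1 • (1 : Matrix _ _ K) := by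
    ext k l
    have h := JJ_SD A (Sum.inr k) (psibar l)
    have h2 : gaDeriv (Sum.inr k) (psibar l : GA K (Fin m ⊕ Fin m)) =
        (1 : Matrix (Fin m) (Fin m) K) k l • (1 : GA K (Fin m ⊕ Fin m)) := by
      have := gaDeriv_ι_mul (K := K) (Sum.inr k) (Pi.single (Sum.inr l) 1 : Fin m ⊕ Fin m → K) 1
      rw [mul_one, gaDeriv_one, mul_zero, sub_zero] at this
      rw [psibar, gaGen, this]
      simp [Pi.single_apply, Matrix.one_apply]
    rw [h2] at h
    simp only [vv, neg_mul, map_neg, neg_inj, Finset.sum_mul, map_sum, smul_mul_assoc, map_smul,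
      smul_eq_mul] at h
    simp only [Matrix.mul_apply, Matrix.of_apply, Matrix.smul_apply, smul_eq_mul]
    rw [h, mul_comm]
  have := congrArg (fun M => (A⁻¹ * M) i j) hM
  simp only [Matrix.nonsing_inv_mul_cancel_left _ _ hA, Matrix.mul_smul, mul_one,
    Matrix.of_apply, Matrix.smul_apply, smul_eq_mul] at this
  rw [this, mul_comm]
end
end

section
/- The key lemma for the massive matrix-tree theorem: for any subset F of {1,…,n}×{1,…,n} and any subset R of {1,…,n}, the Berezin integral Ω_{F,R} := ∫ (dψ̄ dψ)_ent (ψ_J ψ̄_I)_ent · Π_{j∈R} (ψⱼψ̄ⱼ) · Π_{(i,j)∈F} ((ψ̄ᵢ − ψ̄ⱼ)ψⱼ) vanishes unless the pair (F,R) is admissible, in which case Ω_{F,R} = ε(F). -/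
set_option synthInstance.maxHeartbeats 1000000
set_option maxHeartbeats 1000000

noncomputable section

variable {R : Type*} [CommRing R] [Algebra ℚ R]

open scoped Classical

/-- The undirected simple graph underlying a set `F` of directed edges on `{1,…,n}`. -/
def forestGraph {n : ℕ} (F : Finset (Fin n × Fin n)) : SimpleGraph (Fin n) :=
  SimpleGraph.fromRel (fun u v => (u, v) ∈ F)

/-- `F` is a directed forest: no loops, no edge together with its reverse, and the
underlying undirected graph is acyclic. -/
def IsDirForest {n : ℕ} (F : Finset (Fin n × Fin n)) : Prop :=
  (∀ e ∈ F, e.1 ≠ e.2) ∧ (∀ e ∈ F, (e.2, e.1) ∉ F) ∧ (forestGraph F).IsAcyclic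

/-- All edges of `F` lying in the connected component of `r` are oriented away from `r`. -/
def OrientedAway {n : ℕ} (F : Finset (Fin n × Fin n)) (r : Fin n) : Prop :=
  ∀ e ∈ F, (forestGraph F).Reachable r e.1 →
    (forestGraph F).dist r e.2 = (forestGraph F).dist r e.1 + 1

/-- `F` is an admissible directed forest with respect to the index sets `I` and `J`. -/
def AdmissibleForest {n : ℕ} (I J : Finset (Fin n)) (F : Finset (Fin n × Fin n)) : Prop :=
  IsDirForest F ∧
    (∀ v : Fin n, (∃ u ∈ I ∪ J, (forestGraph F).Reachable v u) →
      ((∃! u, u ∈ I ∧ (forestGraph F).Reachable v u) ∧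
        (∃! u, u ∈ J ∧ (forestGraph F).Reachable v u))) ∧
    (∀ j ∈ J, OrientedAway F j)

/-- The pair `(F, Rt)` of a directed forest and a set of roots is admissible with
respect to `I` and `J`. -/
def AdmissiblePair {n : ℕ} (I J : Finset (Fin n)) (F : Finset (Fin n × Fin n))
    (Rt : Finset (Fin n)) : Prop :=
  AdmissibleForest I J F ∧
    (∀ v : Fin n, (¬ ∃ u ∈ I ∪ J, (forestGraph F).Reachable v u) →
      ∃! r, r ∈ Rt ∧ (forestGraph F).Reachable v r) ∧
    (∀ r ∈ Rt, ¬ ∃ u ∈ I ∪ J, (forestGraph F).Reachable r u) ∧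
    (∀ r ∈ Rt, OrientedAway F r)

/-- `σ` is the permutation matching `j_α` with `i_{σ(α)}` through the components of `F`;
its sign is the signature `ε(F)` of the admissible forest `F`. -/
def MatchPerm {n p : ℕ} (I J : Finset (Fin n)) (hI : I.card = p) (hJ : J.card = p)
    (F : Finset (Fin n × Fin n)) (σ : Equiv.Perm (Fin p)) : Prop :=
  ∀ α : Fin p, (forestGraph F).Reachable
    ((J.orderIsoOfFin hJ α) : Fin n) ((I.orderIsoOfFin hI (σ α)) : Fin n)

/-- The Berezin integral
`Ω_{F,R} = ∫ (dψ̄ dψ)_ent (ψ_J ψ̄_I)_ent Π_{j∈R} (ψⱼψ̄ⱼ) Π_{(i,j)∈F} ((ψ̄ᵢ-ψ̄ⱼ)ψⱼ)`. -/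
def omegaFR {R : Type*} [CommRing R] {n : ℕ} (I J : Finset (Fin n))
    (F : Finset (Fin n × Fin n)) (Rt : Finset (Fin n)) : R :=
  gaCoef (bint (entList n)
    (((((J.sort (· ≤ ·)).zip (I.sort (· ≤ ·))).map (fun x => psi x.1 * psibar x.2)).prod) *
      (((Rt.sort (· ≤ ·)).map (fun j => psi j * psibar j)).prod) *
      ((F.toList.map (fun e => (psibar e.1 - psibar e.2) * psi e.2)).prod)))

section helperA
variable {K : Type*} [CommRing K] {n : ℕ}

theorem iota_swap {M : Type*} [AddCommGroup M] [Module K M] (a b : M) :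
    ExteriorAlgebra.ι K a * ExteriorAlgebra.ι K b
      = - (ExteriorAlgebra.ι K b * ExteriorAlgebra.ι K a) :=
  eq_neg_of_add_eq_zero_left (ExteriorAlgebra.ι_add_mul_swap a b)

theorem pair_commute_iota {M : Type*} [AddCommGroup M] [Module K M] (a b c : M) :
    Commute (ExteriorAlgebra.ι K a * ExteriorAlgebra.ι K b) (ExteriorAlgebra.ι K c) := by
  unfold Commute SemiconjBy
  rw [mul_assoc, iota_swap b c, mul_neg, ← mul_assoc, iota_swap a c, neg_mul, neg_neg, mul_assoc]

/-- Embedding of bar-vectors. -/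
def embBar (K : Type*) [CommRing K] (n : ℕ) : (Fin n → K) →ₗ[K] (Fin n ⊕ Fin n → K) where
  toFun r := Sum.elim 0 r
  map_add' a b := by ext (i | i) <;> simp
  map_smul' a b := by ext (i | i) <;> simp

/-- Linear combination of the bar generators. -/
def barL (r : Fin n → K) : GA K (Fin n ⊕ Fin n) := ExteriorAlgebra.ι K (embBar K n r)

theorem psibar_eq (i : Fin n) : (psibar i : GA K (Fin n ⊕ Fin n)) = barL (Pi.single i 1) := by
  unfold psibar gaGen barL
  congr 1
  ext (j | j)
  · simp [embBar]
  · simp [embBar, Pi.single_apply]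

/-- Elementary even factor. -/
def pp (x : Fin n × (Fin n → K)) : GA K (Fin n ⊕ Fin n) := psi x.1 * barL x.2

theorem pp_comm_iota (x : Fin n × (Fin n → K)) (c) :
    Commute (pp x) (ExteriorAlgebra.ι K c) := pair_commute_iota _ _ _

theorem pp_comm (x y : Fin n × (Fin n → K)) : Commute (pp x) (pp y) :=
  (pp_comm_iota x _).mul_right (pp_comm_iota x _)

theorem psi_mul_prod_zero (v : Fin n) (L : List (Fin n × (Fin n → K)))
    (h : v ∈ L.map Prod.fst) : psi v * (L.map pp).prod = 0 := by
  induction L with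
  | nil => simp at h
  | cons x t ih =>
    rw [List.map_cons, List.prod_cons]
    rw [List.map_cons, List.mem_cons] at h
    rcases h with h | h
    · subst h
      unfold pp psi gaGen
      rw [← mul_assoc, ← mul_assoc, ExteriorAlgebra.ι_sq_zero, zero_mul, zero_mul]
    · have : psi v * pp x = pp x * psi v := (pp_comm_iota x _).eq.symm
      rw [← mul_assoc, this, mul_assoc, ih h, mul_zero]

theorem prod_zero_of_dup (L : List (Fin n × (Fin n → K)))
    (h : ¬ (L.map Prod.fst).Nodup) : (L.map pp).prod = 0 := by
  induction L with
  | nil => simp at h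
  | cons x t ih =>
    rw [List.map_cons, List.prod_cons]
    rw [List.map_cons, List.nodup_cons, not_and_or, not_not] at h
    rcases h with h | h
    · have : pp x = - (barL x.2 * psi x.1) := iota_swap _ _
      rw [this, neg_mul, mul_assoc, psi_mul_prod_zero _ _ h, mul_zero, neg_zero]
    · rw [ih h, mul_zero]

theorem gaDeriv_iota_mul (i : Fin n ⊕ Fin n) (a) (b : GA K (Fin n ⊕ Fin n)) :
    gaDeriv i (ExteriorAlgebra.ι K a * b) = a i • b - ExteriorAlgebra.ι K a * gaDeriv i b :=
  CliffordAlgebra.contractLeft_ι_mul (Q := (0 : QuadraticForm K (Fin n ⊕ Fin n → K))) _ _ _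

theorem gaDeriv_one_s13 (i : Fin n ⊕ Fin n) :
    gaDeriv i (1 : GA K (Fin n ⊕ Fin n)) = 0 :=
  CliffordAlgebra.contractLeft_one (Q := (0 : QuadraticForm K (Fin n ⊕ Fin n → K))) _

theorem gaDeriv_comm_s13 (i j : Fin n ⊕ Fin n) (x : GA K (Fin n ⊕ Fin n)) :
    gaDeriv i (gaDeriv j x) = - gaDeriv j (gaDeriv i x) :=
  CliffordAlgebra.contractLeft_comm (Q := (0 : QuadraticForm K (Fin n ⊕ Fin n → K))) _ _ _

theorem gaDeriv_pp_mul (i : Fin n ⊕ Fin n) (x : Fin n × (Fin n → K)) (b)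
    (h1 : i ≠ Sum.inl x.1) (h2 : embBar K n x.2 i = 0) :
    gaDeriv i (pp x * b) = pp x * gaDeriv i b := by
  unfold pp psi gaGen barL
  rw [mul_assoc, gaDeriv_iota_mul, gaDeriv_iota_mul, h2, Pi.single_eq_of_ne h1]
  simp [mul_assoc]

theorem gaDeriv_prod_zero (v : Fin n) (L : List (Fin n × (Fin n → K)))
    (h : v ∉ L.map Prod.fst) : gaDeriv (Sum.inl v) (L.map pp).prod = 0 := by
  induction L with
  | nil => exact gaDeriv_one_s13 _
  | cons x t ih =>
    rw [List.map_cons, List.mem_cons, not_or] at h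
    rw [List.map_cons, List.prod_cons, gaDeriv_pp_mul, ih h.2, mul_zero]
    · simpa using h.1
    · simp [embBar]

theorem bint_zero (l : List (Fin n ⊕ Fin n)) : bint l (0 : GA K (Fin n ⊕ Fin n)) = 0 := by
  induction l with
  | nil => rfl
  | cons x t ih => simp only [bint, ih, map_zero]

theorem bint_smul (l : List (Fin n ⊕ Fin n)) (c : K) (f : GA K (Fin n ⊕ Fin n)) :
    bint l (c • f) = c • bint l f := by
  induction l with
  | nil => rfl
  | cons x t ih => simp only [bint, ih, map_smul]

theorem gaDeriv_bint (i : Fin n ⊕ Fin n) (l : List (Fin n ⊕ Fin n))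
    (f : GA K (Fin n ⊕ Fin n)) (h : gaDeriv i f = 0) : gaDeriv i (bint l f) = 0 := by
  induction l with
  | nil => exact h
  | cons x t ih => rw [bint, gaDeriv_comm_s13, ih, map_zero, neg_zero]

theorem bint_eq_zero (i : Fin n ⊕ Fin n) (l : List (Fin n ⊕ Fin n)) (hi : i ∈ l)
    (f : GA K (Fin n ⊕ Fin n)) (h : gaDeriv i f = 0) : bint l f = 0 := by
  induction l with
  | nil => simp at hi
  | cons x t ih =>
    rw [List.mem_cons] at hi
    rcases hi with rfl | hi
    · exact gaDeriv_bint _ _ _ h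
    · rw [bint, ih hi, map_zero]

theorem entList_eq : entList n =
    ((List.finRange n).map (fun i : Fin n => [Sum.inr i, Sum.inl i])).flatten := by
  unfold entList
  rw [List.ofFn_eq_map]

theorem bint_pp (l : List (Fin n ⊕ Fin n)) (x : Fin n × (Fin n → K)) (b)
    (h : ∀ i ∈ l, i ≠ Sum.inl x.1 ∧ embBar K n x.2 i = 0) :
    bint l (pp x * b) = pp x * bint l b := by
  induction l with
  | nil => rfl
  | cons i t ih =>
    rw [bint, bint, ih (fun j hj => h j (List.mem_cons_of_mem _ hj)), gaDeriv_pp_mul]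
    · exact (h i (by simp)).1
    · exact (h i (by simp)).2

theorem bint_one (l : List (Fin n)) (hl : l.Nodup) :
    bint (l.map (fun i : Fin n => [Sum.inr i, Sum.inl i])).flatten
      ((l.map (fun v => (v, (Pi.single v 1 : Fin n → K)))).map pp).prod = 1 := by
  induction l with
  | nil => rfl
  | cons a t ih =>
    rw [List.nodup_cons] at hl
    simp only [List.map_cons, List.flatten_cons, List.cons_append, List.nil_append, bint,
      List.prod_cons]
    rw [bint_pp, ih hl.2, mul_one]
    · unfold pp psi gaGen barL
      rw [gaDeriv_iota_mul, ← mul_one (ExteriorAlgebra.ι K (embBar K n _)), gaDeriv_iota_mul]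
      simp only [embBar, LinearMap.coe_mk, AddHom.coe_mk, Sum.elim_inl, Pi.zero_apply, zero_smul,
        gaDeriv_one_s13, mul_zero, sub_zero, Pi.single_eq_same, one_smul]
      have := gaDeriv_iota_mul (K := K) (Sum.inr a) (Sum.elim 0 (Pi.single a 1)) 1
      rw [this, gaDeriv_one_s13]
      simp
    · intro i hi
      simp only [List.mem_flatten, List.mem_map] at hi
      obtain ⟨_, ⟨b, hb, rfl⟩, hi⟩ := hi
      have hab : b ≠ a := fun h => hl.1 (h ▸ hb)
      simp at hi
      rcases hi with rfl | rfl
      · simp [embBar, hab]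
      · simp [embBar, hab]

theorem prod_entangle (l : List (Fin n)) :
    ∃ s : K, ∀ r : Fin n → (Fin n → K),
      (l.map (fun v => pp (v, r v))).prod =
        s • ((l.map psi).prod * (l.map (fun v => barL (r v))).prod) := by
  induction l with
  | nil => exact ⟨1, fun r => by simp⟩
  | cons a t ih =>
    obtain ⟨s, hs⟩ := ih
    have key : ∀ (t : List (Fin n)) (r : Fin n → K), barL r * (t.map psi).prod
        = ((-1 : K) ^ t.length) • ((t.map psi).prod * barL r) := by
      intro t r
      induction t with
      | nil => simp
      | cons b t ih =>
        rw [List.map_cons, List.prod_cons, ← mul_assoc]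
        have : barL r * psi b = - (psi b * barL r) := iota_swap _ _
        rw [this, neg_mul, mul_assoc, ih]
        simp [pow_succ, mul_assoc]
    refine ⟨s * (-1) ^ t.length, fun r => ?_⟩
    simp only [List.map_cons, List.prod_cons]
    rw [hs, pp]
    simp only
    rw [mul_smul_comm, mul_assoc, ← mul_assoc (barL _), key]
    simp [mul_assoc, mul_smul]

theorem prod_det (M : Matrix (Fin n) (Fin n) K) :
    ((List.finRange n).map (fun v => pp (v, M v))).prod =
      M.det • ((List.finRange n).map (fun v => pp (v, (Pi.single v 1 : Fin n → K)))).prod := by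
  obtain ⟨s, hs⟩ := prod_entangle (K := K) (List.finRange n)
  have hs2 := hs (fun v => Pi.single v 1)
  rw [hs M, hs2, smul_comm]
  congr 1
  rw [← mul_smul_comm]
  congr 1
  set g : (Fin n → K) [⋀^Fin n]→ₗ[K] GA K (Fin n ⊕ Fin n) :=
    (ExteriorAlgebra.ιMulti K n).compLinearMap (embBar K n) with hg
  have hgr : ∀ r : Fin n → Fin n → K, ((List.finRange n).map (fun v => barL (r v))).prod = g r := by
    intro r
    rw [hg, AlternatingMap.compLinearMap_apply, ExteriorAlgebra.ιMulti_apply, List.ofFn_eq_map]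
    rfl
  have h3 := hgr (fun v => Pi.single v 1)
  rw [hgr M, h3]
  have h4 : g = (LinearMap.toSpanSingleton K _ (g (fun v => Pi.single v 1))).compAlternatingMap
      Matrix.detRowAlternating := by
    refine Module.Basis.ext_alternating (Pi.basisFun K (Fin n)) fun v hv => ?_
    have hb : Function.Bijective v := Finite.injective_iff_bijective.mp hv
    set σ : Equiv.Perm (Fin n) := Equiv.ofBijective v hb with hσ
    have e1 : (fun i => (Pi.basisFun K (Fin n)) (v i)) =
        (fun w => (Pi.single w 1 : Fin n → K)) ∘ σ := by
      ext i
      simp [hσ]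
    rw [e1, AlternatingMap.map_perm, AlternatingMap.map_perm]
    congr 1
    rw [LinearMap.compAlternatingMap_apply]
    have e2 : Matrix.detRowAlternating (fun w => (Pi.single w 1 : Fin n → K)) = 1 := by
      have : (fun w => (Pi.single w 1 : Fin n → K)) = (1 : Matrix (Fin n) (Fin n) K) := by
        ext i j
        simp [Matrix.one_apply, Pi.single_apply, eq_comm]
      rw [this]
      exact Matrix.det_one
    rw [e2]
    simp
  exact DFunLike.congr_fun h4 M

/-- The Berezin functional on lists. -/
theorem ber_zero (L : List (Fin n × (Fin n → K)))
    (h : ¬ (L.map Prod.fst).Perm (List.finRange n)) :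
    gaCoef (bint (entList n) (L.map pp).prod) = 0 := by
  by_cases hd : (L.map Prod.fst).Nodup
  · have : ∃ v, v ∉ L.map Prod.fst := by
      by_contra! hc
      exact h ((List.perm_ext_iff_of_nodup hd (List.nodup_finRange n)).2 (fun a => by simp [hc a]))
    obtain ⟨v, hv⟩ := this
    rw [bint_eq_zero (Sum.inl v) _ _ _ (gaDeriv_prod_zero v L hv), map_zero]
    rw [entList_eq]
    simp
  · rw [prod_zero_of_dup L hd, bint_zero, map_zero]

theorem ber_det (L : List (Fin n × (Fin n → K)))
    (h : (L.map Prod.fst).Perm (List.finRange n)) (M : Matrix (Fin n) (Fin n) K)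
    (hM : ∀ x ∈ L, x.2 = M x.1) :
    gaCoef (bint (entList n) (L.map pp).prod) = M.det := by
  have h1 : L = (L.map Prod.fst).map (fun v => (v, M v)) := by
    rw [List.map_map]
    conv_lhs => rw [← List.map_id L]
    refine List.map_congr_left fun x hx => ?_
    ext1
    · rfl
    · exact hM x hx
  have h2 : L.Perm ((List.finRange n).map (fun v => (v, M v))) := by
    rw [h1]
    have := h.map (fun v => (v, M v))
    rwa [← h1] at this ⊢
  have h3 : (L.map pp).prod = ((List.finRange n).map (fun v => pp (v, M v))).prod := by
    rw [(h2.map pp).prod_eq', List.map_map]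
    · rfl
    · rw [List.pairwise_map]
      exact List.pairwise_of_forall (fun x y => pp_comm x y)
  have h4 := bint_one (K := K) (List.finRange n) (List.nodup_finRange n)
  rw [List.map_map] at h4
  rw [h3, prod_det, bint_smul, entList_eq]
  erw [h4]
  simp

/-- The list of factors. -/
def facL (K : Type*) [CommRing K] {n : ℕ} (I J : Finset (Fin n))
    (F : Finset (Fin n × Fin n)) (Rt : Finset (Fin n)) : List (Fin n × (Fin n → K)) :=
  ((J.sort (· ≤ ·)).zip (I.sort (· ≤ ·))).map (fun x => (x.1, Pi.single x.2 1)) ++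
  (Rt.sort (· ≤ ·)).map (fun j => (j, Pi.single j 1)) ++
  F.toList.map (fun e => (e.2, Pi.single e.2 1 - Pi.single e.1 1))

theorem omegaFR_facL (I J : Finset (Fin n)) (F : Finset (Fin n × Fin n)) (Rt : Finset (Fin n)) :
    (omegaFR I J F Rt : K) = gaCoef (bint (entList n) ((facL K I J F Rt).map pp).prod) := by
  unfold omegaFR facL
  rw [List.map_append, List.map_append, List.prod_append, List.prod_append]
  simp only [List.map_map]
  congr 5
  · congr 1
    ext x
    simp [pp, psibar_eq]
  · congr 1
    ext x
    simp [pp, psibar_eq]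
  · ext x
    simp only [Function.comp, pp]
    have e : barL (Pi.single x.2 1 - Pi.single x.1 1 : Fin n → K)
        = psibar x.2 - psibar x.1 := by
      rw [psibar_eq, psibar_eq, barL, map_sub, map_sub]
      rfl
    have e2 : psi x.2 * barL (Pi.single x.2 1 - Pi.single x.1 1 : Fin n → K) =
      - (barL (Pi.single x.2 1 - Pi.single x.1 1 : Fin n → K) * psi x.2) := iota_swap _ _
    rw [e2, e, ← neg_mul, neg_sub]

theorem facL_fst (I J : Finset (Fin n)) (F : Finset (Fin n × Fin n)) (Rt : Finset (Fin n))
    (h : I.card = J.card) :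
    (facL K I J F Rt).map Prod.fst = J.sort (· ≤ ·) ++ Rt.sort (· ≤ ·) ++ F.toList.map Prod.snd := by
  unfold facL
  rw [List.map_append, List.map_append, List.map_map, List.map_map, List.map_map]
  congr 1
  congr 1
  · have : (Prod.fst ∘ fun x : Fin n × Fin n => (x.1, (Pi.single x.2 1 : Fin n → K))) = Prod.fst :=
      rfl
    rw [this, List.map_fst_zip]
    simp [h]
  · exact List.map_id _

/-- Parent function data. -/
def PF (S : Finset (Fin n)) (F : Finset (Fin n × Fin n)) (par : Fin n → Fin n) : Prop :=
  (∀ v ∈ S, par v = v) ∧ ∀ u v, (u, v) ∈ F ↔ v ∉ S ∧ u = par v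

theorem omega_ne (I J : Finset (Fin n)) (F : Finset (Fin n × Fin n)) (Rt : Finset (Fin n))
    (h : I.card = J.card) (hne : ¬ (omegaFR I J F Rt : K) = 0) :
    Disjoint J Rt ∧ ∃ par, PF (J ∪ Rt) F par := by
  rw [omegaFR_facL] at hne
  have hp := not_imp_comm.1 (ber_zero (K := K) _) hne
  rw [facL_fst _ _ _ _ h] at hp
  have hnd : (J.sort (· ≤ ·) ++ Rt.sort (· ≤ ·) ++ F.toList.map Prod.snd).Nodup :=
    hp.nodup_iff.2 (List.nodup_finRange n)
  have hmem : ∀ v, v ∈ (J.sort (· ≤ ·) ++ Rt.sort (· ≤ ·) ++ F.toList.map Prod.snd) := fun v =>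
    hp.mem_iff.2 (List.mem_finRange v)
  rw [List.nodup_append', List.nodup_append'] at hnd
  obtain ⟨⟨-, -, hd⟩, hF, hd2⟩ := hnd
  refine ⟨?_, ?_⟩
  · rw [Finset.disjoint_left]
    intro a ha hb
    exact hd (by simpa using ha) (by simpa using hb)
  · have hex : ∀ v, ∃ u, (v ∈ J ∪ Rt → u = v) ∧ (v ∉ J ∪ Rt → (u, v) ∈ F) := by
      intro v
      by_cases hv : v ∈ J ∪ Rt
      · exact ⟨v, fun _ => rfl, fun h => absurd hv h⟩
      · have := hmem v
        simp at this hv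
        obtain h1 | h1 | ⟨u, hu⟩ := this
        · exact absurd h1 hv.1
        · exact absurd h1 hv.2
        · exact ⟨u, fun h => absurd h (by simp [hv]), fun _ => hu⟩
    choose par hp1 hp2 using hex
    refine ⟨par, hp1, fun u v => ⟨fun huv => ?_, ?_⟩⟩
    · have hv : v ∉ J ∪ Rt := by
        intro hv
        refine hd2 (a := v) (by simpa using hv) ?_
        simp only [List.mem_map, Finset.mem_toList]
        exact ⟨(u, v), huv, rfl⟩
      refine ⟨hv, ?_⟩
      have := List.inj_on_of_nodup_map hF (x := (u, v)) (by simpa using huv)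
        (y := (par v, v)) (by simpa using hp2 v hv) rfl
      simpa using this
    · rintro ⟨hv, rfl⟩
      exact hp2 v hv

theorem omega_det {p : ℕ} (I J : Finset (Fin n)) (F : Finset (Fin n × Fin n)) (Rt : Finset (Fin n))
    (hI : I.card = p) (hJ : J.card = p) (hdis : Disjoint J Rt) (par) (hpar : PF (J ∪ Rt) F par) :
    ∃ M : Matrix (Fin n) (Fin n) K, (omegaFR I J F Rt : K) = M.det ∧
      (∀ α, M (J.orderIsoOfFin hJ α) = Pi.single ((I.orderIsoOfFin hI α : Fin n)) 1) ∧
      (∀ v ∈ Rt, M v = Pi.single v 1) ∧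
      (∀ v, v ∉ J ∪ Rt → M v = Pi.single v 1 - Pi.single (par v) 1) := by
  have hnd : ((facL K I J F Rt).map Prod.fst).Nodup := by
    rw [facL_fst _ _ _ _ (hI.trans hJ.symm), List.nodup_append', List.nodup_append']
    refine ⟨⟨Finset.sort_nodup _ _, Finset.sort_nodup _ _, ?_⟩, ?_, ?_⟩
    · intro a ha hb
      exact Finset.disjoint_left.1 hdis (by simpa using ha) (by simpa using hb)
    · refine List.Nodup.map_on ?_ F.nodup_toList
      rintro ⟨a, b⟩ hab ⟨c, d⟩ hcd h
      simp only [Finset.mem_toList] at hab hcd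
      simp only at h
      subst h
      rw [((hpar.2 _ _).1 hab).2, ((hpar.2 _ _).1 hcd).2]
    · intro a ha hb
      simp only [List.mem_map, Finset.mem_toList] at hb
      obtain ⟨⟨u, v⟩, he, rfl⟩ := hb
      exact ((hpar.2 _ _).1 he).1 (by simpa using ha)
  have hall : ∀ v, ∃ r, (v, r) ∈ facL K I J F Rt := by
    intro v
    have : v ∈ (facL K I J F Rt).map Prod.fst := by
      rw [facL_fst _ _ _ _ (hI.trans hJ.symm)]
      by_cases hv : v ∈ J ∪ Rt
      · simp at hv ⊢
        tauto
      · have := (hpar.2 (par v) v).2 ⟨hv, rfl⟩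
        simp
        exact Or.inr (Or.inr ⟨_, this⟩)
    rw [List.mem_map] at this
    obtain ⟨⟨a, r⟩, h, rfl⟩ := this
    exact ⟨r, h⟩
  choose M hM using hall
  have hM2 : ∀ x ∈ facL K I J F Rt, x.2 = M x.1 := by
    rintro ⟨v, r⟩ hx
    have := List.inj_on_of_nodup_map hnd hx (hM v) rfl
    simpa using this
  refine ⟨M, ?_, ?_, ?_, ?_⟩
  · rw [omegaFR_facL]
    refine ber_det _ ?_ _ hM2
    refine (List.perm_ext_iff_of_nodup hnd (List.nodup_finRange n)).2 (fun a => ?_)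
    simp only [List.mem_finRange, iff_true]
    exact List.mem_map_of_mem (f := Prod.fst) (hM a)
  · intro α
    refine (hM2 ((J.orderIsoOfFin hJ α : Fin n), Pi.single ((I.orderIsoOfFin hI α : Fin n)) 1) ?_).symm
    unfold facL
    refine List.mem_append_left _ (List.mem_append_left _ ?_)
    rw [List.mem_map]
    refine ⟨((J.orderIsoOfFin hJ α : Fin n), (I.orderIsoOfFin hI α : Fin n)), ?_, rfl⟩
    rw [List.mem_iff_getElem]
    refine ⟨α, ?_, ?_⟩
    · simp [hI, hJ]
    · rw [List.getElem_zip]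
      simp [Finset.orderEmbOfFin_apply]
  · intro v hv
    refine (hM2 (v, Pi.single v 1) ?_).symm
    unfold facL
    refine List.mem_append_left _ (List.mem_append_right _ ?_)
    rw [List.mem_map]
    exact ⟨v, by simpa using hv, rfl⟩
  · intro v hv
    refine (hM2 (v, _) ?_).symm
    unfold facL
    refine List.mem_append_right _ ?_
    rw [List.mem_map]
    exact ⟨(par v, v), by simpa using (hpar.2 (par v) v).2 ⟨hv, rfl⟩, rfl⟩

end helperA
section helperB
variable {K : Type*} [CommRing K] {n : ℕ}

theorem par_iter_root {S : Finset (Fin n)} {F} {par : Fin n → Fin n} (h : PF S F par) {v : Fin n}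
    (hv : v ∈ S) (k : ℕ) : par^[k] v = v :=
  Function.iterate_fixed (h.1 v hv) k

theorem cyc_zero (J Rt : Finset (Fin n)) (F) (par) (hpar : PF (J ∪ Rt) F par)
    (M : Matrix (Fin n) (Fin n) K)
    (hM : ∀ v, v ∉ J ∪ Rt → M v = Pi.single v 1 - Pi.single (par v) 1)
    (v : Fin n) (hv : ∀ k, par^[k] v ∉ J ∪ Rt) : M.det = 0 := by
  obtain ⟨a, b, hab, he⟩ := Finite.exists_ne_map_eq_of_infinite (fun k : ℕ => par^[k] v)
  wlog hlt : a < b generalizing a b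
  · exact this b a hab.symm he.symm (lt_of_le_of_ne (not_lt.1 hlt) hab.symm)
  beta_reduce at he
  set w := par^[a] v with hw
  have hper : w ∈ Function.periodicPts par := by
    refine ⟨b - a, by omega, ?_⟩
    show par^[b - a] w = w
    rw [hw, ← Function.iterate_add_apply, Nat.sub_add_cancel hlt.le, ← he]
  set C : Finset (Fin n) := Finset.univ.filter
    (fun u => u ∈ Function.periodicPts par ∧ u ∉ J ∪ Rt) with hC
  have hmap : ∀ u ∈ C, par u ∈ C := by
    intro u hu
    simp only [hC, Finset.mem_filter, Finset.mem_univ, true_and] at hu ⊢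
    refine ⟨(Function.bijOn_periodicPts par).mapsTo hu.1, fun hp => hu.2 ?_⟩
    obtain ⟨m, hm, hm2⟩ := hu.1
    obtain ⟨m, rfl⟩ : ∃ k, m = k + 1 := ⟨m - 1, by omega⟩
    have : par^[m + 1] u = u := hm2
    rw [Function.iterate_succ_apply, par_iter_root hpar hp] at this
    rwa [this] at hp
  have hinj : Set.InjOn par C := by
    intro x hx y hy hxy
    simp only [hC, Finset.coe_filter, Finset.mem_univ, true_and, Set.mem_ofPred_eq] at hx hy
    exact (Function.bijOn_periodicPts par).injOn hx.1 hy.1 hxy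
  have himg : C.image par = C := by
    refine Finset.eq_of_subset_of_card_le ?_ ?_
    · intro x hx
      obtain ⟨u, hu, rfl⟩ := Finset.mem_image.1 hx
      exact hmap u hu
    · rw [Finset.card_image_of_injOn hinj]
  have hsum : ∑ u ∈ C, M u = 0 := by
    have : ∑ u ∈ C, (Pi.single (par u) 1 : Fin n → K) = ∑ u ∈ C, Pi.single u 1 := by
      conv_rhs => rw [← himg]
      rw [Finset.sum_image hinj]
    rw [← sub_eq_zero_of_eq this.symm, ← Finset.sum_sub_distrib]
    refine Finset.sum_congr rfl fun u hu => hM u ?_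
    simp only [hC, Finset.mem_filter] at hu
    exact hu.2.2
  have hvm : Matrix.vecMul (fun u => if u ∈ C then (1 : K) else 0) M = 0 := by
    ext j
    have : ∑ u ∈ C, M u j = 0 :=
      (Finset.sum_apply j C (fun u => (M u : Fin n → K))).symm.trans (congrFun hsum j)
    simp [Matrix.vecMul, dotProduct, this]
  have h2 : Matrix.vecMul (Matrix.vecMul (fun u => if u ∈ C then (1 : K) else 0) M) M.adjugate = 0 := by
    rw [hvm, Matrix.zero_vecMul]
  rw [Matrix.vecMul_vecMul, Matrix.mul_adjugate] at h2
  have h3 := congrFun h2 w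
  have hwC : w ∈ C := by
    simp only [hC, Finset.mem_filter, Finset.mem_univ, true_and]
    exact ⟨hper, hv a⟩
  simpa [Matrix.vecMul_smul, hwC] using h3

/-- Ancestor relation. -/
def Anc (par : Fin n → Fin n) (w u : Fin n) : Prop := ∃ k, par^[k] w = u

theorem anc_self (par : Fin n → Fin n) (w : Fin n) : Anc par w w := ⟨0, rfl⟩

theorem anc_par (par : Fin n → Fin n) (w u : Fin n) : Anc par w u ↔ w = u ∨ Anc par (par w) u := by
  constructor
  · rintro ⟨k, hk⟩
    cases k with
    | zero => exact Or.inl hk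
    | succ k => exact Or.inr ⟨k, hk⟩
  · rintro (h | ⟨k, hk⟩)
    · exact ⟨0, h⟩
    · exact ⟨k + 1, hk⟩

theorem anc_root {S : Finset (Fin n)} {F} {par : Fin n → Fin n} (h : PF S F par) {v u : Fin n}
    (hv : v ∈ S) (ha : Anc par v u) : v = u := by
  obtain ⟨k, hk⟩ := ha
  rwa [par_iter_root h hv] at hk

/-- Depth function. -/
def IsDepth (S : Finset (Fin n)) (par : Fin n → Fin n) (d : Fin n → ℕ) : Prop :=
  (∀ v ∈ S, d v = 0) ∧ ∀ v, v ∉ S → d v = d (par v) + 1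

theorem exists_depth {S : Finset (Fin n)} {par : Fin n → Fin n}
    (hac : ∀ v, ∃ k, par^[k] v ∈ S) : ∃ d, IsDepth S par d := by
  refine ⟨fun v => Nat.find (hac v), fun v hv => ?_, fun v hv => ?_⟩
  · rw [Nat.find_eq_zero]
    exact hv
  · exact Nat.find_comp_succ (hac v) (hac (par v)) hv

theorem anc_depth {S : Finset (Fin n)} {F} {par : Fin n → Fin n} (h : PF S F par) {d}
    (hd : IsDepth S par d) {w u : Fin n} (ha : Anc par w u) : d u ≤ d w ∧ (d u = d w → w = u) := by
  obtain ⟨k, hk⟩ := ha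
  induction k generalizing w with
  | zero => obtain rfl : w = u := hk; simp
  | succ k ih =>
    rw [Function.iterate_succ_apply] at hk
    by_cases hw : w ∈ S
    · rw [h.1 w hw] at hk
      exact ih hk
    · have h1 := ih hk
      have h2 := hd.2 w hw
      exact ⟨by omega, fun h => by omega⟩

theorem acyc_det {p : ℕ} (I J Rt : Finset (Fin n)) (F) (par) (hpar : PF (J ∪ Rt) F par)
    (hI : I.card = p) (hJ : J.card = p) (hdis : Disjoint J Rt) {d}
    (hd : IsDepth (J ∪ Rt) par d)
    (M : Matrix (Fin n) (Fin n) K)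
    (hM1 : ∀ α, M (J.orderIsoOfFin hJ α) = Pi.single ((I.orderIsoOfFin hI α : Fin n)) 1)
    (hM2 : ∀ v ∈ Rt, M v = Pi.single v 1)
    (hM : ∀ v, v ∉ J ∪ Rt → M v = Pi.single v 1 - Pi.single (par v) 1) :
    M.det = (Matrix.of fun α β : Fin p =>
      if Anc par (I.orderIsoOfFin hI α) (J.orderIsoOfFin hJ β) then (1 : K) else 0).det := by
  set D : Matrix (Fin n) (Fin n) K := Matrix.of fun w u => if Anc par w u then (1 : K) else 0 with hD
  have hDdet : D.det = 1 := by
    have hbt : D.BlockTriangular (fun v => OrderDual.toDual (d v)) := by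
      intro i j hij
      simp only [OrderDual.toDual_lt_toDual] at hij
      simp only [hD, Matrix.of_apply]
      rw [if_neg]
      intro ha
      have := (anc_depth hpar hd ha).1
      omega
    rw [hbt.det]
    refine Finset.prod_eq_one fun a _ => ?_
    have : D.toSquareBlock (fun v => OrderDual.toDual (d v)) a = 1 := by
      ext ⟨i, hi⟩ ⟨j, hj⟩
      simp only [Matrix.toSquareBlock_def, Matrix.of_apply, hD, Matrix.one_apply, Subtype.mk.injEq]
      have hij : d j = d i := OrderDual.toDual.injective (hj.trans hi.symm)
      by_cases h : i = j
      · simp [h, anc_self]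
      · rw [if_neg h, if_neg]
        exact fun ha => h ((anc_depth hpar hd ha).2 hij)
    rw [this, Matrix.det_one]
  have hMD : M.det = (M * D).det := by rw [Matrix.det_mul, hDdet, mul_one]
  have hJrow : ∀ α u, (M * D) (J.orderIsoOfFin hJ α) u =
      if Anc par (I.orderIsoOfFin hI α) u then 1 else 0 := by
    intro α u
    rw [Matrix.mul_apply_eq_vecMul, hM1, Matrix.single_one_vecMul]
    rfl
  have hother : ∀ v, v ∉ J → ∀ u, (M * D) v u = if v = u then 1 else 0 := by
    intro v hv u
    rw [Matrix.mul_apply_eq_vecMul]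
    by_cases hr : v ∈ Rt
    · rw [hM2 v hr, Matrix.single_one_vecMul]
      have : Anc par v u ↔ v = u :=
        ⟨anc_root hpar (Finset.mem_union_right _ hr), fun h => h ▸ anc_self _ _⟩
      simp [hD, this]
    · have hvS : v ∉ J ∪ Rt := by simp [hv, hr]
      rw [hM v hvS, Matrix.sub_vecMul, Matrix.single_one_vecMul, Matrix.single_one_vecMul]
      simp only [hD, Pi.sub_apply, Matrix.row_apply, Matrix.of_apply]
      rw [anc_par par v u]
      by_cases h : v = u
      · have : ¬ Anc par (par v) u := by
          intro ha
          have h1 := (anc_depth hpar hd ha).1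
          have h2 := hd.2 v hvS
          rw [h] at h1 h2
          omega
        rw [if_pos (Or.inl h), if_neg this, if_pos h, sub_zero]
      · simp [h]
  rw [hMD, Matrix.twoBlockTriangular_det _ (fun v => v ∈ J)]
  · have e1 : (M * D).toSquareBlockProp (fun v => ¬ v ∈ J) = 1 := by
      ext ⟨i, hi⟩ ⟨j, hj⟩
      simp only [Matrix.toSquareBlockProp_def, Matrix.of_apply, Matrix.one_apply, Subtype.mk.injEq]
      exact hother i hi j
    rw [e1, Matrix.det_one, mul_one]
    let e : Fin p ≃ {v // (fun v => v ∈ J) v} := (J.orderIsoOfFin hJ).toEquiv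
    trans (((M * D).toSquareBlockProp (fun v => v ∈ J)).submatrix e e).det
    · symm
      convert Matrix.det_submatrix_equiv_self (R := K) e _
    congr 1
    ext α β
    exact hJrow α _
  · intro i hi j hj
    rw [hother i hi, if_neg]
    rintro rfl
    exact hi hj

end helperB
section helperC
variable {n : ℕ}

theorem fg_adj (F : Finset (Fin n × Fin n)) (u v : Fin n) :
    (forestGraph F).Adj u v ↔ u ≠ v ∧ ((u, v) ∈ F ∨ (v, u) ∈ F) := by
  unfold forestGraph
  rw [SimpleGraph.fromRel_adj]

theorem reach_inv {V X : Type*} (G : SimpleGraph V) (f : V → X) (h : ∀ u v, G.Adj u v → f u = f v)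
    {u v : V} (hr : G.Reachable u v) : f u = f v := by
  obtain ⟨w⟩ := hr
  induction w with
  | nil => rfl
  | cons ha _ ih => exact (h _ _ ha).trans ih

theorem anc_unique {S : Finset (Fin n)} {F} {par : Fin n → Fin n} (h : PF S F par) {v s t : Fin n}
    (hs : s ∈ S) (ht : t ∈ S) (h1 : Anc par v s) (h2 : Anc par v t) : s = t := by
  obtain ⟨a, ha⟩ := h1
  obtain ⟨b, hb⟩ := h2
  have e1 : par^[b + a] v = s := by
    rw [Function.iterate_add_apply, ha, par_iter_root h hs]
  have e2 : par^[a + b] v = t := by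
    rw [Function.iterate_add_apply, hb, par_iter_root h ht]
  rw [← e1, ← e2, add_comm]

theorem exists_rt {S : Finset (Fin n)} {F} {par : Fin n → Fin n} (h : PF S F par) {d}
    (hd : IsDepth S par d) : ∃ rt : Fin n → Fin n, (∀ v, rt v ∈ S) ∧
      (∀ v s, s ∈ S → (Anc par v s ↔ rt v = s)) ∧
      (∀ u v, (forestGraph F).Reachable u v ↔ rt u = rt v) ∧
      (∀ v, (forestGraph F).dist (rt v) v = d v) := by
  have hw : ∀ k v, d v = k → ∃ s ∈ S, Anc par v s ∧
      ∃ w : (forestGraph F).Walk s v, w.length = k := by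
    intro k
    induction k with
    | zero =>
      intro v hv
      have : v ∈ S := by
        by_contra hc
        have := hd.2 v hc
        omega
      exact ⟨v, this, anc_self _ _, SimpleGraph.Walk.nil, rfl⟩
    | succ k ih =>
      intro v hv
      have hvS : v ∉ S := by
        intro hc
        have := hd.1 v hc
        omega
      have h1 := hd.2 v hvS
      obtain ⟨s, hs, ha, w, hw⟩ := ih (par v) (by omega)
      have hadj : (forestGraph F).Adj (par v) v := by
        rw [fg_adj]
        refine ⟨fun he => ?_, Or.inl ((h.2 _ _).2 ⟨hvS, rfl⟩)⟩
        rw [he] at h1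
        omega
      exact ⟨s, hs, (anc_par _ _ _).2 (Or.inr ha), w.concat hadj, by simp [hw]⟩
  choose rt hS hanc hwalk using fun v => hw (d v) v rfl
  have hiff : ∀ v s, s ∈ S → (Anc par v s ↔ rt v = s) := fun v s hs =>
    ⟨fun ha => anc_unique h (hS v) hs (hanc v) ha, fun he => he ▸ hanc v⟩
  have hpar : ∀ v, rt v = rt (par v) := fun v =>
    (hiff v _ (hS _)).1 ((anc_par _ _ _).2 (Or.inr (hanc (par v))))
  have hF : ∀ u v, (u, v) ∈ F → rt v = rt u ∧ d v = d u + 1 := by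
    intro u v huv
    obtain ⟨h1, rfl⟩ := (h.2 _ _).1 huv
    exact ⟨hpar v, hd.2 v h1⟩
  refine ⟨rt, hS, hiff, fun u v => ⟨fun hr => ?_, fun he => ?_⟩, fun v => ?_⟩
  · refine reach_inv _ rt (fun a b hab => ?_) hr
    rw [fg_adj] at hab
    rcases hab.2 with h1 | h1
    · exact (hF _ _ h1).1.symm
    · exact (hF _ _ h1).1
  · obtain ⟨w1, -⟩ := hwalk u
    obtain ⟨w2, -⟩ := hwalk v
    rw [← he] at w2
    exact ⟨w1.reverse.append w2⟩
  · obtain ⟨w, hw⟩ := hwalk v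
    refine le_antisymm (hw ▸ SimpleGraph.dist_le w) ?_
    have hlen : ∀ a b (w : (forestGraph F).Walk a b), d b ≤ d a + w.length := by
      intro a b w
      induction w with
      | nil => simp
      | cons ha _ ih =>
        rw [fg_adj] at ha
        rw [SimpleGraph.Walk.length_cons]
        rcases ha.2 with h1 | h1
        · have := (hF _ _ h1).2
          omega
        · have := (hF _ _ h1).2
          omega
    obtain ⟨w', hw'⟩ := SimpleGraph.Reachable.exists_walk_length_eq_dist ⟨w⟩
    have := hlen _ _ w'
    rw [hd.1 _ (hS v)] at this
    omega

theorem pf_forest {S : Finset (Fin n)} {F} {par : Fin n → Fin n} (h : PF S F par) {d}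
    (hd : IsDepth S par d) : IsDirForest F := by
  have hF : ∀ u v, (u, v) ∈ F → d v = d u + 1 := by
    intro u v huv
    obtain ⟨h1, rfl⟩ := (h.2 _ _).1 huv
    exact hd.2 v h1
  refine ⟨?_, ?_, ?_⟩
  · rintro ⟨u, v⟩ he h1
    have := hF _ _ he
    simp only at h1
    subst h1
    omega
  · rintro ⟨u, v⟩ he h1
    have h2 := hF u v he
    have h3 := hF v u h1
    omega
  · rw [SimpleGraph.isAcyclic_iff_forall_adj_isBridge]
    have key : ∀ u v, (u, v) ∈ F → (forestGraph F).IsBridge s(u, v) := by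
      intro u v huv
      rw [SimpleGraph.isBridge_iff]
      intro hr
      have hi := reach_inv _ (fun w => Anc par w v) (fun a b hab => ?_) hr
      · have h2 : Anc par u v := by
          rw [eq_iff_iff] at hi
          exact hi.2 (anc_self _ _)
        have h3 := (anc_depth h hd h2).1
        have := hF _ _ huv
        omega
      · rw [SimpleGraph.deleteEdges_adj, fg_adj] at hab
        obtain ⟨⟨hne, hab⟩, hne2⟩ := hab
        have step : ∀ a b, (a, b) ∈ F → s(a, b) ≠ s(u, v) → (Anc par b v ↔ Anc par a v) := by
          intro a b hab hne
          obtain ⟨h1, rfl⟩ := (h.2 _ _).1 hab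
          rw [anc_par par b v]
          constructor
          · rintro (rfl | h4)
            · exact absurd (by rw [((h.2 _ _).1 huv).2]) hne
            · exact h4
          · exact Or.inr
        rw [eq_iff_iff]
        rcases hab with h1 | h1
        · exact (step _ _ h1 (by simpa using hne2)).symm
        · refine step _ _ h1 ?_
          rw [Sym2.eq_swap]
          simpa using hne2
    intro u v huv
    rw [fg_adj] at huv
    rcases huv.2 with h1 | h1
    · exact key _ _ h1
    · rw [Sym2.eq_swap]
      exact key _ _ h1

theorem adm_of {p : ℕ} (I J Rt : Finset (Fin n)) (F) (par) (hpar : PF (J ∪ Rt) F par)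
    (hI : I.card = p) (hJ : J.card = p) (hdis : Disjoint J Rt) {d}
    (hd : IsDepth (J ∪ Rt) par d)
    (hcol : ∀ β, ∃ α, Anc par (I.orderIsoOfFin hI α) (J.orderIsoOfFin hJ β)) :
    AdmissiblePair I J F Rt := by
  obtain ⟨rt, hS, hanc, hreach, hdist⟩ := exists_rt hpar hd
  have hrs : ∀ s ∈ J ∪ Rt, rt s = s := fun s hs => (hanc s s hs).1 (anc_self _ _)
  choose g hg using hcol
  have hg' : ∀ β, rt (I.orderIsoOfFin hI (g β)) = J.orderIsoOfFin hJ β := fun β =>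
    (hanc _ _ (Finset.mem_union_left _ (J.orderIsoOfFin hJ β).2)).1 (hg β)
  have hginj : Function.Injective g := by
    intro a b hab
    have h1 := hg' a
    rw [hab, hg' b] at h1
    exact ((J.orderIsoOfFin hJ).injective (Subtype.ext h1)).symm
  have hgs : Function.Surjective g := Finite.injective_iff_surjective.1 hginj
  have hIsur : ∀ i ∈ I, ∃ β, i = I.orderIsoOfFin hI (g β) := by
    intro i hi
    obtain ⟨α, hα⟩ := (I.orderIsoOfFin hI).surjective ⟨i, hi⟩
    obtain ⟨β, rfl⟩ := hgs α
    exact ⟨β, by rw [hα]⟩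
  have hJsur : ∀ j ∈ J, ∃ β, j = J.orderIsoOfFin hJ β := by
    intro j hj
    obtain ⟨α, hα⟩ := (J.orderIsoOfFin hJ).surjective ⟨j, hj⟩
    exact ⟨α, by rw [hα]⟩
  have hIJ : ∀ u ∈ I ∪ J, rt u ∈ J := by
    intro u hu
    rw [Finset.mem_union] at hu
    rcases hu with hu | hu
    · obtain ⟨β, rfl⟩ := hIsur u hu
      rw [hg']
      exact (J.orderIsoOfFin hJ β).2
    · rw [hrs u (Finset.mem_union_left _ hu)]
      exact hu
  have hOA : ∀ r ∈ J ∪ Rt, OrientedAway F r := by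
    rintro r hr ⟨u, v⟩ he hre
    obtain ⟨h1, rfl⟩ := (hpar.2 _ _).1 he
    have h2 := (hreach _ _).1 hre
    rw [hrs r hr] at h2
    simp only at h2 ⊢
    have h3 : rt v = r := by
      refine (hanc v r hr).1 ((anc_par _ _ _).2 (Or.inr ((hanc _ _ hr).2 h2.symm)))
    have h4 := hdist v
    have h5 := hdist (par v)
    rw [← h2] at h5
    rw [h3] at h4
    rw [h4, h5, hd.2 v h1]
  refine ⟨⟨pf_forest hpar hd, ?_, fun j hj => hOA j (Finset.mem_union_left _ hj)⟩, ?_, ?_,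
    fun j hj => hOA j (Finset.mem_union_right _ hj)⟩
  · rintro v ⟨u, hu, hvu⟩
    have hvJ : rt v ∈ J := by
      rw [(hreach _ _).1 hvu]
      exact hIJ u hu
    constructor
    · obtain ⟨β, hβ⟩ := hJsur _ hvJ
      refine ⟨I.orderIsoOfFin hI (g β), ⟨(I.orderIsoOfFin hI (g β)).2, ?_⟩, ?_⟩
      · rw [hreach, hg', hβ]
      · rintro w ⟨hw, hvw⟩
        obtain ⟨γ, rfl⟩ := hIsur w hw
        rw [hreach, hg', hβ] at hvw
        rw [(J.orderIsoOfFin hJ).injective (Subtype.ext hvw)]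
    · refine ⟨rt v, ⟨hvJ, ?_⟩, ?_⟩
      · rw [hreach, hrs _ (Finset.mem_union_left _ hvJ)]
      · rintro w ⟨hw, hvw⟩
        rw [hreach, hrs w (Finset.mem_union_left _ hw)] at hvw
        exact hvw.symm
  · intro v hv
    have hvJ : rt v ∉ J := by
      intro hc
      refine hv ⟨rt v, Finset.mem_union_right _ hc, ?_⟩
      rw [hreach, hrs _ (Finset.mem_union_left _ hc)]
    have hvR : rt v ∈ Rt := (Finset.mem_union.1 (hS v)).resolve_left hvJ
    refine ⟨rt v, ⟨hvR, ?_⟩, ?_⟩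
    · rw [hreach, hrs _ (Finset.mem_union_right _ hvR)]
    · rintro w ⟨hw, hvw⟩
      rw [hreach, hrs w (Finset.mem_union_right _ hw)] at hvw
      exact hvw.symm
  · rintro r hr ⟨u, hu, hru⟩
    rw [hreach, hrs r (Finset.mem_union_right _ hr)] at hru
    exact Finset.disjoint_left.1 hdis (hIJ u hu) (hru ▸ hr)

theorem of_adm (I J Rt : Finset (Fin n)) (F) (h : AdmissiblePair I J F Rt) :
    Disjoint J Rt ∧ ∃ par, PF (J ∪ Rt) F par ∧ ∃ d, IsDepth (J ∪ Rt) par d := by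
  obtain ⟨⟨⟨hloop, -, hacyc⟩, hcomp, hOJ⟩, hcompR, hRt, hOR⟩ := h
  have hOA : ∀ r ∈ J ∪ Rt, OrientedAway F r := by
    intro r hr
    rw [Finset.mem_union] at hr
    exact hr.elim (hOJ r) (hOR r)
  have hroot : ∀ v, ∃ r ∈ J ∪ Rt, (forestGraph F).Reachable r v := by
    intro v
    by_cases hv : ∃ u ∈ I ∪ J, (forestGraph F).Reachable v u
    · obtain ⟨-, u, ⟨hu, hu2⟩, -⟩ := hcomp v hv
      exact ⟨u, Finset.mem_union_left _ hu, hu2.symm⟩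
    · obtain ⟨u, ⟨hu, hu2⟩, -⟩ := hcompR v hv
      exact ⟨u, Finset.mem_union_right _ hu, hu2.symm⟩
  have hadj : ∀ u v, (u, v) ∈ F → (forestGraph F).Adj u v := by
    intro u v huv
    rw [fg_adj]
    exact ⟨hloop _ huv, Or.inl huv⟩
  have hnot : ∀ u v, (u, v) ∈ F → v ∉ J ∪ Rt := by
    intro u v huv hv
    have := hOA v hv (u, v) huv (hadj _ _ huv).symm.reachable
    simp at this
  have huniq : ∀ u u' v, (u, v) ∈ F → (u', v) ∈ F → u = u' := by
    intro u u' v h1 h2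
    obtain ⟨r, hr, hrv⟩ := hroot v
    have r1 : (forestGraph F).Reachable r u := hrv.trans (hadj _ _ h1).symm.reachable
    have r2 : (forestGraph F).Reachable r u' := hrv.trans (hadj _ _ h2).symm.reachable
    have d1 := hOA r hr _ h1 r1
    have d2 := hOA r hr _ h2 r2
    simp only at d1 d2
    obtain ⟨w1, hw1⟩ := r1.exists_walk_length_eq_dist
    obtain ⟨w2, hw2⟩ := r2.exists_walk_length_eq_dist
    have p1 := (w1.concat (hadj _ _ h1)).isPath_of_length_eq_dist (by simp [hw1, d1])
    have p2 := (w2.concat (hadj _ _ h2)).isPath_of_length_eq_dist (by simp [hw2, d2])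
    have he := hacyc.path_unique ⟨_, p1⟩ ⟨_, p2⟩
    have he2 := congrArg Subtype.val he
    exact (SimpleGraph.Walk.concat_inj he2).1
  have hcov : ∀ v, v ∉ J ∪ Rt → ∃ u, (u, v) ∈ F := by
    intro v hv
    obtain ⟨r, hr, hrv⟩ := hroot v
    obtain ⟨w, hw⟩ := hrv.symm.exists_walk_length_eq_dist
    cases w with
    | nil => exact absurd hr hv
    | cons ha w' =>
      rename_i u
      rw [fg_adj] at ha
      rcases ha.2 with h1 | h1
      · exfalso
        have h2 := hOA r hr _ h1 hrv
        have h3 := SimpleGraph.dist_le w'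
        simp only at h2
        rw [SimpleGraph.Walk.length_cons] at hw
        rw [SimpleGraph.dist_comm] at hw h3
        omega
      · exact ⟨u, h1⟩
  refine ⟨?_, ?_⟩
  · rw [Finset.disjoint_left]
    intro r hJ hR
    exact hRt r hR ⟨r, Finset.mem_union_right _ hJ, SimpleGraph.Reachable.refl _⟩
  have hex : ∀ v, ∃ u, (v ∈ J ∪ Rt → u = v) ∧ (v ∉ J ∪ Rt → (u, v) ∈ F) := by
    intro v
    by_cases hv : v ∈ J ∪ Rt
    · exact ⟨v, fun _ => rfl, fun h => absurd hv h⟩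
    · obtain ⟨u, hu⟩ := hcov v hv
      exact ⟨u, fun h => absurd h hv, fun _ => hu⟩
  choose par hp1 hp2 using hex
  refine ⟨par, ⟨hp1, fun u v => ⟨fun huv => ?_, ?_⟩⟩, exists_depth fun v => ?_⟩
  · have hv := hnot _ _ huv
    exact ⟨hv, huniq _ _ v huv (hp2 v hv)⟩
  · rintro ⟨hv, rfl⟩
    exact hp2 v hv
  · obtain ⟨r, hr, hrv⟩ := hroot v
    have key : ∀ k v, (forestGraph F).Reachable r v → (forestGraph F).dist r v = k →
        ∃ k, par^[k] v ∈ J ∪ Rt := by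
      intro k
      induction k with
      | zero =>
        intro v h1 h2
        rw [h1.dist_eq_zero_iff] at h2
        exact ⟨0, h2 ▸ hr⟩
      | succ k ih =>
        intro v h1 h2
        by_cases hv : v ∈ J ∪ Rt
        · exact ⟨0, hv⟩
        · have h3 := hp2 v hv
          have h4 := h1.trans (hadj _ _ h3).symm.reachable
          have h5 := hOA r hr _ h3 h4
          simp only at h5
          obtain ⟨m, hm⟩ := ih (par v) h4 (by omega)
          exact ⟨m + 1, hm⟩
    exact key _ v hrv rfl

end helperC

/-- Key lemma for the massive matrix-tree theorem: `Ω_{F,R}` vanishes unless the pair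
`(F,R)` is admissible, in which case it equals the signature `ε(F)`. -/
theorem omegaFR_eq (n p : ℕ) (I J : Finset (Fin n)) (hI : I.card = p) (hJ : J.card = p)
    (F : Finset (Fin n × Fin n)) (Rt : Finset (Fin n)) :
    (∀ σ : Equiv.Perm (Fin p), AdmissiblePair I J F Rt → MatchPerm I J hI hJ F σ →
        (omegaFR I J F Rt : R) = ((Equiv.Perm.sign σ : ℤ) : R)) ∧
      (¬ AdmissiblePair I J F Rt → (omegaFR I J F Rt : R) = 0) := by
  constructor
  · intro σ hadm hmatch
    obtain ⟨hdis, par, hpar, d, hd⟩ := of_adm I J Rt F hadm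
    obtain ⟨M, hM0, hM1, hM2, hM3⟩ := omega_det (K := R) I J F Rt hI hJ hdis par hpar
    rw [hM0, acyc_det I J Rt F par hpar hI hJ hdis hd M hM1 hM2 hM3]
    obtain ⟨rt, hS, hanc, hreach, hdist⟩ := exists_rt hpar hd
    have hrs : ∀ s ∈ J ∪ Rt, rt s = s := fun s hs => (hanc s s hs).1 (anc_self _ _)
    have hJm : ∀ β, ((J.orderIsoOfFin hJ β : J) : Fin n) ∈ J ∪ Rt := fun β =>
      Finset.mem_union_left _ (J.orderIsoOfFin hJ β).2
    have hrtσ : ∀ β, rt (I.orderIsoOfFin hI (σ β)) = J.orderIsoOfFin hJ β := by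
      intro β
      have h1 := (hreach _ _).1 (hmatch β)
      rw [← h1, hrs _ (hJm β)]
    have hent : ∀ α β, Anc par (I.orderIsoOfFin hI α) (J.orderIsoOfFin hJ β) ↔ σ β = α := by
      intro α β
      rw [hanc _ _ (hJm β)]
      constructor
      · intro h1
        have h2 := hrtσ (σ.symm α)
        rw [Equiv.apply_symm_apply, h1] at h2
        have h3 := (J.orderIsoOfFin hJ).injective (Subtype.ext h2)
        rw [h3, Equiv.apply_symm_apply]
      · rintro rfl
        exact hrtσ β
    rw [← Matrix.det_permutation σ, ← Matrix.det_transpose]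
    congr 1
    ext β α
    rw [Matrix.transpose_apply, Matrix.of_apply, if_congr (hent α β) rfl rfl]
    simp [Equiv.toPEquiv_apply, PEquiv.toMatrix_apply, eq_comm]
  · intro hadm
    by_contra hne
    obtain ⟨hdis, par, hpar⟩ := omega_ne (K := R) I J F Rt (hI.trans hJ.symm) hne
    obtain ⟨M, hM0, hM1, hM2, hM3⟩ := omega_det (K := R) I J F Rt hI hJ hdis par hpar
    by_cases hac : ∀ v, ∃ k, par^[k] v ∈ J ∪ Rt
    · obtain ⟨d, hd⟩ := exists_depth hac
      by_cases hcol : ∀ β, ∃ α, Anc par (I.orderIsoOfFin hI α) (J.orderIsoOfFin hJ β)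
      · exact hadm (adm_of I J Rt F par hpar hI hJ hdis hd hcol)
      · push Not at hcol
        obtain ⟨β, hβ⟩ := hcol
        apply hne
        rw [hM0, acyc_det I J Rt F par hpar hI hJ hdis hd M hM1 hM2 hM3]
        refine Matrix.det_eq_zero_of_column_eq_zero β fun α => ?_
        rw [Matrix.of_apply, if_neg (hβ α)]
    · push Not at hac
      obtain ⟨v, hv⟩ := hac
      exact hne (hM0.trans (cyc_zero J Rt F par hpar M hM3 v hv))
end
end
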